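/- arXiv:math/0407078 — 4 statements merged into one kernel-verified Lean document; each statement's English description precedes it below -/
import Mathlib

section
/- For $0<q<1$ and every real $x$ with $|x|<1$, Euler's second expansion holds: $(x;q)_\infty=\sum_{n\ge 0}\frac{(-1)^n q^{n(n-1)/2}x^n}{(q;q)_n}$, the series converging absolutely. -/
/-- The q-Pochhammer symbol `(q;q)_n = ∏_{j=1}^{n} (1 - qʲ)`. -/
noncomputable def qPochQ (q : ℝ) (n : ℕ) : ℝ := ∏ j ∈ Finset.range n, (1 - q ^ (j + 1))

/-- The infinite q-Pochhammer symbol `(x;q)_∞ = ∏_{n≥0} (1 - qⁿ x)`. -/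
noncomputable def qPochInf (q x : ℝ) : ℝ := ∏' n : ℕ, (1 - q ^ n * x)

/-- The `n`-th term of Euler's second expansion. -/
noncomputable def eulerTerm (q x : ℝ) (n : ℕ) : ℝ :=
  (-1 : ℝ) ^ n * q ^ (n * (n - 1) / 2) * x ^ n / qPochQ q n

lemma one_sub_pow_succ_pos {q : ℝ} (hq : 0 < q) (hq1 : q < 1) (n : ℕ) : 0 < 1 - q ^ (n + 1) :=
  sub_pos.2 (pow_lt_one₀ hq.le hq1 n.succ_ne_zero)

lemma qPochQ_pos {q : ℝ} (hq : 0 < q) (hq1 : q < 1) (n : ℕ) : 0 < qPochQ q n :=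
  Finset.prod_pos fun j _ => one_sub_pow_succ_pos hq hq1 j

lemma eulerTerm_zero_right (q x : ℝ) : eulerTerm q x 0 = 1 := by
  simp [eulerTerm, qPochQ]

lemma eulerTerm_mul (q x y : ℝ) (n : ℕ) : eulerTerm q (y * x) n = y ^ n * eulerTerm q x n := by
  simp only [eulerTerm, mul_pow]
  ring

lemma eulerTerm_succ {q : ℝ} (hq : 0 < q) (hq1 : q < 1) (x : ℝ) (n : ℕ) :
    eulerTerm q x (n + 1) = -(q ^ n * x / (1 - q ^ (n + 1))) * eulerTerm q x n := by
  have hexp : (n + 1) * (n + 1 - 1) / 2 = n * (n - 1) / 2 + n := by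
    rw [← Finset.sum_range_id, ← Finset.sum_range_id, Finset.sum_range_succ]
  have hprod : qPochQ q (n + 1) = qPochQ q n * (1 - q ^ (n + 1)) :=
    Finset.prod_range_succ _ _
  have h₁ := (one_sub_pow_succ_pos hq hq1 n).ne'
  have h₂ := (qPochQ_pos hq hq1 n).ne'
  simp only [eulerTerm]
  rw [hexp, hprod]
  field_simp
  ring

lemma summable_eulerTerm {q : ℝ} (hq : 0 < q) (hq1 : q < 1) (x : ℝ) :
    Summable (eulerTerm q x) := by
  have hpow := tendsto_pow_atTop_nhds_zero_of_lt_one hq.le hq1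
  have hlim : Filter.Tendsto (fun n : ℕ => ‖-(q ^ n * x / (1 - q ^ (n + 1)))‖)
      Filter.atTop (nhds 0) := by
    have h := (((hpow.mul_const x).div
      (((Filter.tendsto_add_atTop_iff_nat 1).2 hpow).const_sub 1) (by norm_num)).neg).norm
    simpa using h
  refine summable_of_ratio_norm_eventually_le (r := 1 / 2) (by norm_num) ?_
  filter_upwards [hlim.eventually_le_const (by norm_num : (0 : ℝ) < 1 / 2)] with n hn
  rw [eulerTerm_succ hq hq1, norm_mul]
  gcongr

lemma tsum_eulerTerm_eq_mul {q : ℝ} (hq : 0 < q) (hq1 : q < 1) (x : ℝ) :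
    ∑' n, eulerTerm q x n = (1 - x) * ∑' n, eulerTerm q (q * x) n := by
  have hs := summable_eulerTerm hq hq1 x
  have hs' := summable_eulerTerm hq hq1 (q * x)
  have hterm (n : ℕ) : eulerTerm q x (n + 1)
      = eulerTerm q (q * x) (n + 1) - x * eulerTerm q (q * x) n := by
    have h₁ := (one_sub_pow_succ_pos hq hq1 n).ne'
    rw [eulerTerm_mul, eulerTerm_mul, eulerTerm_succ hq hq1]
    field_simp
    ring
  have h := hs'.tsum_eq_zero_add
  rw [hs.tsum_eq_zero_add, tsum_congr hterm,
    ((summable_nat_add_iff 1).2 hs').tsum_sub (hs'.mul_left x), tsum_mul_left]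
  rw [eulerTerm_zero_right] at h ⊢
  linarith

lemma tsum_eulerTerm_eq_prod_mul {q : ℝ} (hq : 0 < q) (hq1 : q < 1) (x : ℝ) (N : ℕ) :
    ∑' n, eulerTerm q x n
      = (∏ k ∈ Finset.range N, (1 - q ^ k * x)) * ∑' n, eulerTerm q (q ^ N * x) n := by
  induction N with
  | zero => simp
  | succ N ih =>
    rw [ih, tsum_eulerTerm_eq_mul hq hq1 (q ^ N * x), Finset.prod_range_succ, mul_assoc,
      ← mul_assoc q, ← pow_succ']

lemma tendsto_tsum_eulerTerm_pow_mul {q : ℝ} (hq : 0 < q) (hq1 : q < 1) (x : ℝ) :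
    Filter.Tendsto (fun N : ℕ => ∑' n, eulerTerm q (q ^ N * x) n) Filter.atTop (nhds 1) := by
  have hone : ∑' n : ℕ, (if n = 0 then (1 : ℝ) else 0) = 1 := tsum_ite_eq 0 _
  rw [← hone]
  refine tendsto_tsum_of_dominated_convergence (summable_eulerTerm hq hq1 x).norm ?_ ?_
  · rintro (_ | n)
    · simp [eulerTerm_zero_right]
    · have h := (((tendsto_pow_atTop_nhds_zero_of_lt_one hq.le hq1).pow (n + 1)).mul_const
        (eulerTerm q x (n + 1)))
      simpa [eulerTerm_mul] using h
  · refine Filter.Eventually.of_forall fun N n => ?_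
    rw [eulerTerm_mul, norm_mul]
    refine mul_le_of_le_one_left (norm_nonneg _) ?_
    rw [Real.norm_of_nonneg (by positivity)]
    exact pow_le_one₀ (by positivity) (pow_le_one₀ hq.le hq1.le)

lemma tendsto_prod_qPochInf {q : ℝ} (hq : 0 < q) (hq1 : q < 1) (x : ℝ) :
    Filter.Tendsto (fun N : ℕ => ∏ k ∈ Finset.range N, (1 - q ^ k * x)) Filter.atTop
      (nhds (qPochInf q x)) := by
  have hs : Summable fun n : ℕ => ‖-(q ^ n * x)‖ :=
    ((summable_geometric_of_lt_one hq.le hq1).mul_right x).neg.norm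
  have hm : Multipliable fun n : ℕ => 1 - q ^ n * x := by
    simpa [sub_eq_add_neg] using multipliable_one_add_of_summable hs
  exact hm.hasProd.tendsto_prod_nat

/-- Euler's second expansion: for `0 < q < 1` and `|x| < 1`,
`(x;q)_∞ = ∑_{n≥0} (-1)ⁿ q^{n(n-1)/2} xⁿ/(q;q)_n`, the series converging absolutely. -/
theorem euler_second_expansion (q x : ℝ) (hq : 0 < q) (hq1 : q < 1) (hx : |x| < 1) :
    (Summable fun n : ℕ => |(-1 : ℝ) ^ n * q ^ (n * (n - 1) / 2) * x ^ n / qPochQ q n|) ∧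
      qPochInf q x = ∑' n : ℕ, (-1 : ℝ) ^ n * q ^ (n * (n - 1) / 2) * x ^ n / qPochQ q n := by
  refine ⟨(summable_eulerTerm hq hq1 x).abs, ?_⟩
  have h := (tendsto_prod_qPochInf hq hq1 x).mul (tendsto_tsum_eulerTerm_pow_mul hq hq1 x)
  simp only [← tsum_eulerTerm_eq_prod_mul hq hq1 x, mul_one] at h
  exact tendsto_nhds_unique h tendsto_const_nhds
end

section
/- Fix $a,z\in(0,1)$ and for each $q\in(0,1)$ let $g_q(x)=\frac{\phi_q(a q^{x})}{\phi_q(q^{1+x})}\,z^x$ and $S(g_q)=\sum_{n\ge 0}g_q(n)$. Then $\lim_{q\to 1^-}\ln(q)\,\ln S(g_q)=F(\xi_0)$, where $\xi_0=\frac{1-z}{1-az}$ and $F(\xi)=\mathrm{Li}_2(\xi)-\mathrm{Li}_2(a\xi)+\ln(\xi)\ln(z)$. -/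
/-- The Euler dilogarithm `Li₂(x) = ∑_{n≥1} xⁿ/n²`. -/
noncomputable def Li2 (x : ℝ) : ℝ := ∑' n : ℕ, x ^ (n + 1) / ((n : ℝ) + 1) ^ 2

/-- `φ_q(y) = 1/∏_{n≥0}(1 - qⁿ y)`. -/
noncomputable def phi (q y : ℝ) : ℝ := 1 / ∏' n : ℕ, (1 - q ^ n * y)

open Filter Topology Set

/-- The `q`-Pochhammer symbol `(y; q)_∞ = ∏_{n≥0} (1 - qⁿ y)`. -/
noncomputable def qPoch (q y : ℝ) : ℝ := ∏' n : ℕ, (1 - q ^ n * y)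

section QPochhammer

variable {q : ℝ}

lemma summable_pow_mul_const (hq : q ∈ Ioo (0 : ℝ) 1) (y : ℝ) :
    Summable fun n : ℕ => q ^ n * y :=
  (summable_geometric_of_lt_one hq.1.le hq.2).mul_right y

lemma multipliable_qPoch (hq : q ∈ Ioo (0 : ℝ) 1) (y : ℝ) :
    Multipliable fun n : ℕ => 1 - q ^ n * y := by
  simpa [sub_eq_add_neg] using
    Real.multipliable_one_add_of_summable (summable_pow_mul_const hq y).neg

lemma summable_log_one_sub_pow_mul (hq : q ∈ Ioo (0 : ℝ) 1) (y : ℝ) :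
    Summable fun n : ℕ => Real.log (1 - q ^ n * y) := by
  simpa [sub_eq_add_neg] using
    Real.summable_log_one_add_of_summable (summable_pow_mul_const hq y).neg

lemma pow_mul_lt_one (hq : q ∈ Ioo (0 : ℝ) 1) {y : ℝ} (hy : y ∈ Ioo (0 : ℝ) 1) (n : ℕ) :
    q ^ n * y < 1 :=
  (mul_le_of_le_one_left hy.1.le (pow_le_one₀ hq.1.le hq.2.le)).trans_lt hy.2

lemma exp_tsum_log_eq_qPoch (hq : q ∈ Ioo (0 : ℝ) 1) {y : ℝ} (hy : y ∈ Ioo (0 : ℝ) 1) :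
    Real.exp (∑' n : ℕ, Real.log (1 - q ^ n * y)) = qPoch q y :=
  Real.rexp_tsum_eq_tprod (fun n => sub_pos.2 (pow_mul_lt_one hq hy n))
    (summable_log_one_sub_pow_mul hq y)

lemma qPoch_pos (hq : q ∈ Ioo (0 : ℝ) 1) {y : ℝ} (hy : y ∈ Ioo (0 : ℝ) 1) :
    0 < qPoch q y := by
  rw [← exp_tsum_log_eq_qPoch hq hy]
  exact Real.exp_pos _

lemma log_qPoch (hq : q ∈ Ioo (0 : ℝ) 1) {y : ℝ} (hy : y ∈ Ioo (0 : ℝ) 1) :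
    Real.log (qPoch q y) = ∑' n : ℕ, Real.log (1 - q ^ n * y) := by
  rw [← exp_tsum_log_eq_qPoch hq hy, Real.log_exp]

lemma qPoch_eq_mul (hq : q ∈ Ioo (0 : ℝ) 1) (y : ℝ) :
    qPoch q y = (1 - y) * qPoch q (q * y) := by
  have hshift (n : ℕ) : 1 - q ^ (n + 1) * y = 1 - q ^ n * (q * y) := by ring
  have h : Multipliable fun n : ℕ => 1 - q ^ (n + 1) * y := by
    simpa only [hshift] using multipliable_qPoch hq (q * y)
  have h1 := tprod_eq_zero_mul' (f := fun n : ℕ => 1 - q ^ n * y) h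
  simpa only [qPoch, hshift, pow_zero, one_mul] using h1

/-- Expansion of `log (y; q)_∞` as a Lambert series. -/
lemma log_qPoch_eq_neg_tsum (hq : q ∈ Ioo (0 : ℝ) 1) {y : ℝ} (hy : y ∈ Ioo (0 : ℝ) 1) :
    Real.log (qPoch q y) = -∑' k : ℕ, y ^ (k + 1) / ((k + 1) * (1 - q ^ (k + 1))) := by
  have hsum (n : ℕ) : HasSum (fun k : ℕ => (q ^ n * y) ^ (k + 1) / ((k : ℝ) + 1))
      (-Real.log (1 - q ^ n * y)) := by
    apply Real.hasSum_pow_div_log_of_abs_lt_one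
    rw [abs_of_nonneg (mul_nonneg (pow_nonneg hq.1.le n) hy.1.le)]
    exact pow_mul_lt_one hq hy n
  have hs : Summable (Function.uncurry fun n k : ℕ => (q ^ n * y) ^ (k + 1) / ((k : ℝ) + 1)) := by
    rw [summable_prod_of_nonneg]
    · refine ⟨fun n => (hsum n).summable, ?_⟩
      simpa only [Function.uncurry_apply_pair, (hsum _).tsum_eq] using
        (summable_log_one_sub_pow_mul hq y).neg
    · rintro ⟨n, k⟩
      have := hq.1
      have := hy.1
      simp only [Function.uncurry_apply_pair, Pi.zero_apply]
      positivity
  rw [log_qPoch hq hy, ← neg_eq_iff_eq_neg, ← tsum_neg]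
  simp_rw [← (hsum _).tsum_eq]
  rw [← hs.tsum_comm]
  refine tsum_congr fun k => ?_
  have hk : q ^ (k + 1) < 1 := pow_lt_one₀ hq.1.le hq.2 k.succ_ne_zero
  have hk0 : (0 : ℝ) ≤ q ^ (k + 1) := pow_nonneg hq.1.le _
  have heq (n : ℕ) : (q ^ n * y) ^ (k + 1) / ((k : ℝ) + 1)
      = (q ^ (k + 1)) ^ n * (y ^ (k + 1) / (k + 1)) := by
    rw [mul_pow, ← pow_mul, ← pow_mul, mul_comm n]
    ring
  simp_rw [heq]
  rw [tsum_mul_right, tsum_geometric_of_lt_one hk0 hk]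
  have : (1 - q ^ (k + 1)) ≠ 0 := (sub_pos.2 hk).ne'
  field_simp

end QPochhammer

section Binomial

variable {q a z : ℝ}

/-- The coefficients `(qⁿ⁺¹; q)_∞ / (a qⁿ; q)_∞`, proportional to `(a; q)_n / (q; q)_n`. -/
noncomputable def qBinomCoeff (q a : ℝ) (n : ℕ) : ℝ :=
  qPoch q (q ^ (n + 1)) / qPoch q (a * q ^ n)

lemma mul_pow_mem_Ioo (hq : q ∈ Ioo (0 : ℝ) 1) (ha : a ∈ Ioo (0 : ℝ) 1) (n : ℕ) :
    a * q ^ n ∈ Ioo (0 : ℝ) 1 :=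
  ⟨mul_pos ha.1 (pow_pos hq.1 n), mul_comm a _ ▸ pow_mul_lt_one hq ha n⟩

lemma pow_succ_mem_Ioo (hq : q ∈ Ioo (0 : ℝ) 1) (n : ℕ) : q ^ (n + 1) ∈ Ioo (0 : ℝ) 1 :=
  ⟨pow_pos hq.1 _, pow_lt_one₀ hq.1.le hq.2 n.succ_ne_zero⟩

lemma qBinomCoeff_pos (hq : q ∈ Ioo (0 : ℝ) 1) (ha : a ∈ Ioo (0 : ℝ) 1) (n : ℕ) :
    0 < qBinomCoeff q a n :=
  div_pos (qPoch_pos hq (pow_succ_mem_Ioo hq n)) (qPoch_pos hq (mul_pow_mem_Ioo hq ha n))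

lemma qBinomCoeff_succ (hq : q ∈ Ioo (0 : ℝ) 1) (ha : a ∈ Ioo (0 : ℝ) 1) (n : ℕ) :
    qBinomCoeff q a (n + 1) * (1 - q ^ (n + 1)) = qBinomCoeff q a n * (1 - a * q ^ n) := by
  have h1 := qPoch_eq_mul hq (q ^ (n + 1))
  have h2 := qPoch_eq_mul hq (a * q ^ n)
  rw [show q * q ^ (n + 1) = q ^ (n + 1 + 1) by ring] at h1
  rw [show q * (a * q ^ n) = a * q ^ (n + 1) by ring] at h2
  have h3 := (qPoch_pos hq (mul_pow_mem_Ioo hq ha (n + 1))).ne'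
  have h4 : 1 - a * q ^ n ≠ 0 := (sub_pos.2 (mul_pow_mem_Ioo hq ha n).2).ne'
  unfold qBinomCoeff
  rw [h1, h2]
  field_simp

lemma summable_qBinomCoeff_mul_pow (hq : q ∈ Ioo (0 : ℝ) 1) (ha : a ∈ Ioo (0 : ℝ) 1)
    (hz : z ∈ Ioo (0 : ℝ) 1) : Summable fun n : ℕ => qBinomCoeff q a n * z ^ n := by
  refine summable_of_ratio_test_tendsto_lt_one hz.2
    (Eventually.of_forall fun n => (mul_pos (qBinomCoeff_pos hq ha n) (pow_pos hz.1 n)).ne') ?_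
  have heq (n : ℕ) : ‖qBinomCoeff q a (n + 1) * z ^ (n + 1)‖ / ‖qBinomCoeff q a n * z ^ n‖
      = (1 - a * q ^ n) / (1 - q ^ (n + 1)) * z := by
    have h0 := qBinomCoeff_pos hq ha n
    have h1 := qBinomCoeff_pos hq ha (n + 1)
    have hz0 := hz.1
    rw [Real.norm_of_nonneg (by positivity), Real.norm_of_nonneg (by positivity)]
    have h2 : 1 - q ^ (n + 1) ≠ 0 := (sub_pos.2 (pow_succ_mem_Ioo hq n).2).ne'
    have h3 := qBinomCoeff_succ hq ha n
    rw [div_mul_eq_mul_div, div_eq_div_iff (by positivity) h2, pow_succ z]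
    linear_combination z ^ n * z * h3
  simp_rw [heq]
  have hpow := tendsto_pow_atTop_nhds_zero_of_lt_one hq.1.le hq.2
  have hpow' := (tendsto_add_atTop_iff_nat 1).2 hpow
  have := (((hpow.const_mul a).const_sub 1).div (hpow'.const_sub 1) (by norm_num)).mul_const z
  simpa using this

lemma one_sub_mul_tsum_qBinomCoeff (hq : q ∈ Ioo (0 : ℝ) 1) (ha : a ∈ Ioo (0 : ℝ) 1)
    (hz : z ∈ Ioo (0 : ℝ) 1) :
    (1 - z) * ∑' n : ℕ, qBinomCoeff q a n * z ^ n
      = (1 - a * z) * ∑' n : ℕ, qBinomCoeff q a n * (q * z) ^ n := by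
  have hqz : q * z ∈ Ioo (0 : ℝ) 1 := by
    simpa [mul_comm] using mul_pow_mem_Ioo hq hz 1
  have s1 := summable_qBinomCoeff_mul_pow hq ha hz
  have s2 := summable_qBinomCoeff_mul_pow hq ha hqz
  have e1 := s1.tsum_eq_zero_add
  have e2 := s2.tsum_eq_zero_add
  have key : ∑' n : ℕ, qBinomCoeff q a (n + 1) * z ^ (n + 1)
        - ∑' n : ℕ, qBinomCoeff q a (n + 1) * (q * z) ^ (n + 1)
      = z * ∑' n : ℕ, qBinomCoeff q a n * z ^ n
        - a * z * ∑' n : ℕ, qBinomCoeff q a n * (q * z) ^ n := by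
    rw [← ((summable_nat_add_iff 1).2 s1).tsum_sub ((summable_nat_add_iff 1).2 s2),
      ← tsum_mul_left, ← tsum_mul_left, ← (s1.mul_left z).tsum_sub (s2.mul_left (a * z))]
    refine tsum_congr fun n => ?_
    have := qBinomCoeff_succ hq ha n
    simp only [mul_pow]
    linear_combination z ^ (n + 1) * this
  simp only [pow_zero] at e1 e2
  linear_combination e1 - e2 + key

lemma tsum_qBinomCoeff_mul_prod (hq : q ∈ Ioo (0 : ℝ) 1) (ha : a ∈ Ioo (0 : ℝ) 1)
    (hz : z ∈ Ioo (0 : ℝ) 1) (N : ℕ) :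
    (∏ i ∈ Finset.range N, (1 - q ^ i * z)) * ∑' n : ℕ, qBinomCoeff q a n * z ^ n
      = (∏ i ∈ Finset.range N, (1 - q ^ i * (a * z))) *
        ∑' n : ℕ, qBinomCoeff q a n * (z * q ^ N) ^ n := by
  induction N with
  | zero => simp
  | succ N ih =>
    have h := one_sub_mul_tsum_qBinomCoeff hq ha (mul_pow_mem_Ioo hq hz N)
    rw [show q * (z * q ^ N) = z * q ^ (N + 1) by ring] at h
    rw [Finset.prod_range_succ, Finset.prod_range_succ]
    linear_combination (1 - q ^ N * z) * ih +
      (∏ i ∈ Finset.range N, (1 - q ^ i * (a * z))) * h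

/-- The `q`-binomial theorem. -/
lemma tsum_qBinomCoeff (hq : q ∈ Ioo (0 : ℝ) 1) (ha : a ∈ Ioo (0 : ℝ) 1)
    (hz : z ∈ Ioo (0 : ℝ) 1) :
    qPoch q z * ∑' n : ℕ, qBinomCoeff q a n * z ^ n
      = qPoch q (a * z) * (qPoch q q / qPoch q a) := by
  have hlim : Tendsto (fun N : ℕ => ∑' n : ℕ, qBinomCoeff q a n * (z * q ^ N) ^ n) atTop
      (𝓝 (∑' n : ℕ, qBinomCoeff q a n * 0 ^ n)) := by
    refine tendsto_tsum_of_dominated_convergence (summable_qBinomCoeff_mul_pow hq ha hz)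
      (fun n => ?_) (Eventually.of_forall fun N n => ?_)
    · refine (Tendsto.pow ?_ n).const_mul _
      simpa using (tendsto_pow_atTop_nhds_zero_of_lt_one hq.1.le hq.2).const_mul z
    · have h0 := qBinomCoeff_pos hq ha n
      have h1 := mul_pow_mem_Ioo hq hz N
      have h2 := h1.1
      rw [Real.norm_of_nonneg (by positivity)]
      gcongr
      exact mul_le_of_le_one_right hz.1.le (pow_le_one₀ hq.1.le hq.2.le)
  have h0 : ∑' n : ℕ, qBinomCoeff q a n * 0 ^ n = qPoch q q / qPoch q a := by
    rw [tsum_eq_single 0 (fun n hn => by simp [hn])]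
    simp [qBinomCoeff]
  rw [h0] at hlim
  have h1 := (multipliable_qPoch hq z).hasProd.tendsto_prod_nat.mul_const
    (∑' n : ℕ, qBinomCoeff q a n * z ^ n)
  have h2 := (multipliable_qPoch hq (a * z)).hasProd.tendsto_prod_nat.mul hlim
  simp_rw [tsum_qBinomCoeff_mul_prod hq ha hz] at h1
  exact tendsto_nhds_unique h1 h2

end Binomial

section Asymptotics

lemma summable_one_div_succ_sq : Summable fun n : ℕ => 1 / ((n : ℝ) + 1) ^ 2 := by
  simpa using (summable_nat_add_iff 1).2 (Real.summable_one_div_nat_pow.2 one_lt_two)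

lemma neg_log_mul_div_le {q : ℝ} (hq : q ∈ Ioo (0 : ℝ) 1) (k : ℕ) :
    -Real.log q * (q ^ (k + 1) / (1 - q ^ (k + 1))) ≤ 1 / ((k : ℝ) + 1) := by
  have hm := pow_succ_mem_Ioo hq k
  have h := Real.one_sub_inv_le_log_of_pos hm.1
  rw [Real.log_pow] at h
  have h1 : 0 < 1 - q ^ (k + 1) := sub_pos.2 hm.2
  have h2 : q ^ (k + 1) * (q ^ (k + 1))⁻¹ = 1 := mul_inv_cancel₀ hm.1.ne'
  have h3 := mul_le_mul_of_nonneg_left h hm.1.le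
  push_cast at h3
  rw [← mul_div_assoc, div_le_div_iff₀ h1 (by positivity)]
  linarith

lemma le_neg_log_mul_div {q : ℝ} (hq : q ∈ Ioo (0 : ℝ) 1) (k : ℕ) :
    q ^ (k + 1) / ((k : ℝ) + 1) ≤ -Real.log q * (q ^ (k + 1) / (1 - q ^ (k + 1))) := by
  have hm := pow_succ_mem_Ioo hq k
  have h := Real.log_le_sub_one_of_pos hm.1
  rw [Real.log_pow] at h
  have h1 : 0 < 1 - q ^ (k + 1) := sub_pos.2 hm.2
  have h3 := mul_le_mul_of_nonneg_left h hm.1.le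
  push_cast at h3
  rw [← mul_div_assoc, div_le_div_iff₀ (by positivity) h1]
  linarith

lemma tendsto_neg_log_mul_div (k : ℕ) :
    Tendsto (fun q : ℝ => -Real.log q * (q ^ (k + 1) / (1 - q ^ (k + 1))))
      (𝓝[Ioo 0 1] 1) (𝓝 (1 / ((k : ℝ) + 1))) := by
  have hc : Tendsto (fun q : ℝ => q ^ (k + 1) / ((k : ℝ) + 1)) (𝓝[Ioo 0 1] 1)
      (𝓝 (1 / ((k : ℝ) + 1))) := by
    have : Continuous fun q : ℝ => q ^ (k + 1) / ((k : ℝ) + 1) := by fun_prop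
    simpa using (this.tendsto 1).mono_left nhdsWithin_le_nhds
  refine tendsto_of_tendsto_of_tendsto_of_le_of_le' hc tendsto_const_nhds ?_ ?_
  · filter_upwards [self_mem_nhdsWithin] with q hq using le_neg_log_mul_div hq k
  · filter_upwards [self_mem_nhdsWithin] with q hq using neg_log_mul_div_le hq k

lemma tendsto_log_mul_log_qPoch_mul {y : ℝ} (hy : y ∈ Ioc (0 : ℝ) 1) :
    Tendsto (fun q : ℝ => Real.log q * Real.log (qPoch q (q * y))) (𝓝[Ioo 0 1] 1)
      (𝓝 (Li2 y)) := by
  have h : Tendsto (fun q : ℝ => ∑' k : ℕ, -Real.log q * (q ^ (k + 1) / (1 - q ^ (k + 1))) *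
      (y ^ (k + 1) / (k + 1))) (𝓝[Ioo 0 1] 1)
      (𝓝 (∑' k : ℕ, 1 / ((k : ℝ) + 1) * (y ^ (k + 1) / (k + 1)))) := by
    refine tendsto_tsum_of_dominated_convergence summable_one_div_succ_sq
      (fun k => (tendsto_neg_log_mul_div k).mul_const _) ?_
    filter_upwards [self_mem_nhdsWithin] with q hq k
    have h0 := (div_pos (pow_succ_mem_Ioo hq k).1 (by positivity : (0 : ℝ) < k + 1)).le.trans
      (le_neg_log_mul_div hq k)
    have hy0 := hy.1
    rw [Real.norm_of_nonneg (by positivity), sq, ← one_div_mul_one_div]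
    gcongr
    · exact neg_log_mul_div_le hq k
    · exact pow_le_one₀ hy.1.le hy.2
  have hL : ∑' k : ℕ, 1 / ((k : ℝ) + 1) * (y ^ (k + 1) / (k + 1)) = Li2 y :=
    tsum_congr fun k => by field_simp
  rw [hL] at h
  refine h.congr' ?_
  filter_upwards [self_mem_nhdsWithin] with q hq
  have hqy : q * y ∈ Ioo (0 : ℝ) 1 :=
    ⟨mul_pos hq.1 hy.1, (mul_le_of_le_one_right hq.1.le hy.2).trans_lt hq.2⟩
  rw [log_qPoch_eq_neg_tsum hq hqy, ← neg_mul_comm, ← tsum_mul_left]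
  refine tsum_congr fun k => ?_
  rw [mul_pow]
  have : (1 - q ^ (k + 1)) ≠ 0 := (sub_pos.2 (pow_succ_mem_Ioo hq k).2).ne'
  field_simp

lemma tendsto_log_mul_log_qPoch {y : ℝ} (hy : y ∈ Ioo (0 : ℝ) 1) :
    Tendsto (fun q : ℝ => Real.log q * Real.log (qPoch q y)) (𝓝[Ioo 0 1] 1)
      (𝓝 (Li2 y)) := by
  have hlog : Tendsto (fun q : ℝ => Real.log q * Real.log (1 - y)) (𝓝[Ioo 0 1] 1) (𝓝 0) := by
    have := (Real.continuousAt_log one_ne_zero).tendsto.mono_left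
      (nhdsWithin_le_nhds (s := Ioo 0 1))
    simpa using this.mul_const (Real.log (1 - y))
  have h := hlog.add (tendsto_log_mul_log_qPoch_mul ⟨hy.1, hy.2.le⟩)
  rw [zero_add] at h
  refine h.congr' ?_
  filter_upwards [self_mem_nhdsWithin] with q hq
  have h1 : q * y ∈ Ioo (0 : ℝ) 1 := by simpa [mul_comm] using mul_pow_mem_Ioo hq hy 1
  rw [qPoch_eq_mul hq y, Real.log_mul (sub_pos.2 hy.2).ne' (qPoch_pos hq h1).ne', mul_add]

end Asymptotics

section Dilogarithm

lemma continuousOn_Li2 : ContinuousOn Li2 (Icc 0 1) := by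
  unfold Li2
  refine continuousOn_tsum (fun n => by fun_prop) summable_one_div_succ_sq fun n x hx => ?_
  have := hx.1
  rw [Real.norm_of_nonneg (by positivity)]
  gcongr
  exact pow_le_one₀ hx.1 hx.2

lemma hasDerivAt_Li2 {x : ℝ} (hx : x ∈ Ioo (0 : ℝ) 1) :
    HasDerivAt Li2 (-Real.log (1 - x) / x) x := by
  obtain ⟨r, hxr, hr⟩ := exists_between hx.2
  have hr0 : 0 < r := hx.1.trans hxr
  have h := hasDerivAt_tsum_of_isPreconnected (𝕜 := ℝ)
    (g := fun (n : ℕ) (y : ℝ) => y ^ (n + 1) / ((n : ℝ) + 1) ^ 2)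
    (g' := fun (n : ℕ) (y : ℝ) => y ^ n / ((n : ℝ) + 1))
    (t := Ioo 0 r) (y₀ := x) (y := x)
    (summable_geometric_of_lt_one hr0.le hr) isOpen_Ioo isPreconnected_Ioo
    (fun n y _ => by
      have h := (hasDerivAt_pow (n + 1) y).div_const (((n : ℝ) + 1) ^ 2)
      refine h.congr_deriv ?_
      push_cast
      field_simp)
    (fun n y hy => by
      have := hy.1
      rw [Real.norm_of_nonneg (by positivity)]
      calc y ^ n / ((n : ℝ) + 1) ≤ y ^ n := div_le_self (by positivity) (by simp)
        _ ≤ r ^ n := by gcongr; exact hy.2.le)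
    ⟨hx.1, hxr⟩
    (by
      have := hx.1
      refine summable_one_div_succ_sq.of_nonneg_of_le (fun n => by positivity) fun n => ?_
      gcongr
      exact pow_le_one₀ hx.1.le hx.2.le)
    ⟨hx.1, hxr⟩
  have hsum : ∑' n : ℕ, x ^ n / ((n : ℝ) + 1) = -Real.log (1 - x) / x := by
    have hlog := (Real.hasSum_pow_div_log_of_abs_lt_one
      (abs_lt.2 ⟨by linarith [hx.1], hx.2⟩)).div_const x
    rw [← hlog.tsum_eq]
    refine tsum_congr fun n => ?_
    have := hx.1.ne'
    rw [pow_succ]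
    field_simp
  rw [hsum] at h
  exact h

variable {a : ℝ}

lemma one_sub_div_mem_Ioo (ha : a ∈ Ioo (0 : ℝ) 1) {z : ℝ} (hz : z ∈ Ioo (0 : ℝ) 1) :
    (1 - z) / (1 - a * z) ∈ Ioo (0 : ℝ) 1 := by
  have h1 : a * z < z := mul_lt_of_lt_one_left hz.1 ha.2
  have h2 : 0 < 1 - a * z := by linarith [hz.2]
  exact ⟨div_pos (sub_pos.2 hz.2) h2, (div_lt_one h2).2 (by linarith)⟩

lemma mul_mem_Ioo {x y : ℝ} (hx : x ∈ Ioo (0 : ℝ) 1) (hy : y ∈ Ioo (0 : ℝ) 1) :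
    x * y ∈ Ioo (0 : ℝ) 1 :=
  ⟨mul_pos hx.1 hy.1, mul_lt_one_of_nonneg_of_lt_one_left hx.1.le hx.2 hy.2.le⟩

lemma hasDerivAt_one_sub_div {z : ℝ} (h : 1 - a * z ≠ 0) :
    HasDerivAt (fun z : ℝ => (1 - z) / (1 - a * z)) ((a - 1) / (1 - a * z) ^ 2) z := by
  have h1 := ((hasDerivAt_id z).const_sub 1).div (((hasDerivAt_id z).const_mul a).const_sub 1) h
  refine h1.congr_deriv ?_
  rw [id]
  ring

/-- The defect of the five-term relation for the dilogarithm. -/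
noncomputable def fiveTermDefect (a z : ℝ) : ℝ :=
  Li2 ((1 - z) / (1 - a * z)) - Li2 (a * ((1 - z) / (1 - a * z))) +
    Real.log ((1 - z) / (1 - a * z)) * Real.log z - (Li2 (a * z) - Li2 z)

lemma hasDerivAt_fiveTermDefect (ha : a ∈ Ioo (0 : ℝ) 1) {z : ℝ} (hz : z ∈ Ioo (0 : ℝ) 1) :
    HasDerivAt (fiveTermDefect a) 0 z := by
  have hξ := one_sub_div_mem_Ioo ha hz
  have haz := mul_mem_Ioo ha hz
  have h1 : 0 < 1 - a * z := sub_pos.2 haz.2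
  have h2 : 0 < 1 - z := sub_pos.2 hz.2
  have h3 : 0 < 1 - a := sub_pos.2 ha.2
  have hd := hasDerivAt_one_sub_div h1.ne'
  have d1 := (hasDerivAt_Li2 hξ).comp z hd
  have d2 := (hasDerivAt_Li2 (mul_mem_Ioo ha hξ)).comp z (hd.const_mul a)
  have d3 := (hd.log hξ.1.ne').mul (Real.hasDerivAt_log hz.1.ne')
  have d4 := (hasDerivAt_Li2 haz).comp z ((hasDerivAt_id z).const_mul a)
  have d5 := hasDerivAt_Li2 hz
  have key := ((d1.sub d2).add d3).sub (d4.sub d5)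
  refine key.congr_deriv ?_
  have e1 : 1 - (1 - z) / (1 - a * z) = z * ((1 - a) / (1 - a * z)) := by
    rw [one_sub_div h1.ne']
    ring
  have e2 : 1 - a * ((1 - z) / (1 - a * z)) = (1 - a) / (1 - a * z) := by
    rw [← mul_div_assoc, one_sub_div h1.ne']
    ring
  rw [e1, e2, Real.log_mul hz.1.ne' (div_pos h3 h1).ne', Real.log_div h3.ne' h1.ne',
    Real.log_div h2.ne' h1.ne']
  have hz0 := hz.1.ne'
  have ha0 := ha.1.ne'
  field_simp
  ring

lemma tendsto_log_one_sub_div_mul_log :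
    Tendsto (fun z : ℝ => Real.log ((1 - z) / (1 - a * z)) * Real.log z) (𝓝[>] 0) (𝓝 0) := by
  have hd : HasDerivAt (fun z : ℝ => Real.log ((1 - z) / (1 - a * z))) _ 0 :=
    (hasDerivAt_one_sub_div (a := a) (z := 0) (by simp)).log (by simp)
  have h1 := (hasDerivAt_iff_tendsto_slope.1 hd).mono_left
    (nhdsWithin_mono 0 fun x (hx : x ∈ Ioi 0) => ne_of_gt hx)
  have h2 := tendsto_log_mul_rpow_nhdsGT_zero one_pos
  have h3 := h1.mul h2
  rw [mul_zero] at h3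
  refine h3.congr' ?_
  filter_upwards [self_mem_nhdsWithin] with z hz
  have hz0 : z ≠ 0 := ne_of_gt hz
  simp only [slope_def_field, Real.rpow_one]
  norm_num
  field_simp

lemma tendsto_fiveTermDefect (ha : a ∈ Ioo (0 : ℝ) 1) :
    Tendsto (fiveTermDefect a) (𝓝[>] 0) (𝓝 (Li2 1 - Li2 a)) := by
  have hI : Ioo (0 : ℝ) 1 ∈ 𝓝[>] (0 : ℝ) := Ioo_mem_nhdsGT one_pos
  have hLi {f : ℝ → ℝ} {y : ℝ} (hy : y ∈ Icc (0 : ℝ) 1) (hf : ContinuousAt f 0) (hf0 : f 0 = y)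
      (hm : ∀ z ∈ Ioo (0 : ℝ) 1, f z ∈ Ioo (0 : ℝ) 1) :
      Tendsto (fun z => Li2 (f z)) (𝓝[>] 0) (𝓝 (Li2 y)) := by
    refine (continuousOn_Li2 y hy).tendsto.comp (tendsto_nhdsWithin_iff.2 ⟨?_, ?_⟩)
    · rw [← hf0]
      exact hf.tendsto.mono_left nhdsWithin_le_nhds
    · filter_upwards [hI] with z hz using Ioo_subset_Icc_self (hm z hz)
  have hc : ContinuousAt (fun z : ℝ => (1 - z) / (1 - a * z)) 0 :=
    (hasDerivAt_one_sub_div (by simp)).continuousAt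
  have t1 := hLi (y := 1) (by simp) hc (by simp) fun z hz => one_sub_div_mem_Ioo ha hz
  have t2 := hLi (y := a) (Ioo_subset_Icc_self ha) (hc.const_mul a) (by simp)
    fun z hz => mul_mem_Ioo ha (one_sub_div_mem_Ioo ha hz)
  have t4 := hLi (f := fun z => a * z) (y := 0) (by simp) (by fun_prop) (by simp)
    fun z hz => mul_mem_Ioo ha hz
  have t5 := hLi (f := fun z => z) (y := 0) (by simp) (by fun_prop) rfl fun z hz => hz
  have h := ((t1.sub t2).add (tendsto_log_one_sub_div_mul_log (a := a))).sub (t4.sub t5)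
  unfold fiveTermDefect
  simpa using h

lemma fiveTermDefect_eq (ha : a ∈ Ioo (0 : ℝ) 1) {z : ℝ} (hz : z ∈ Ioo (0 : ℝ) 1) :
    fiveTermDefect a z = Li2 1 - Li2 a := by
  refine tendsto_nhds_unique (tendsto_const_nhds.congr' ?_) (tendsto_fiveTermDefect ha)
  filter_upwards [Ioo_mem_nhdsGT one_pos] with w hw
  exact isOpen_Ioo.is_const_of_deriv_eq_zero isPreconnected_Ioo
    (fun x hx => (hasDerivAt_fiveTermDefect ha hx).differentiableAt.differentiableWithinAt)
    (fun x hx => (hasDerivAt_fiveTermDefect ha hx).deriv) hz hw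

end Dilogarithm

/-- For fixed `a, z ∈ (0,1)`, with `g_q(x) = φ_q(a qˣ) zˣ / φ_q(q^{1+x})` and
`S(g_q) = ∑_{n≥0} g_q(n)`, one has
`lim_{q→1⁻} ln(q) ln S(g_q) = F(ξ₀)` where `ξ₀ = (1-z)/(1-az)` and
`F(ξ) = Li₂(ξ) - Li₂(aξ) + ln(ξ) ln(z)`. -/
theorem limit_log_sum (a z : ℝ) (ha : a ∈ Set.Ioo (0 : ℝ) 1) (hz : z ∈ Set.Ioo (0 : ℝ) 1) :
    Filter.Tendsto
      (fun q : ℝ => Real.log q *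
        Real.log (∑' n : ℕ, phi q (a * q ^ (n : ℕ)) * z ^ (n : ℕ) / phi q (q ^ (n + 1))))
      (nhdsWithin 1 (Set.Ioo (0 : ℝ) 1))
      (nhds (Li2 ((1 - z) / (1 - a * z)) - Li2 (a * ((1 - z) / (1 - a * z))) +
        Real.log ((1 - z) / (1 - a * z)) * Real.log z)) := by
  have haz := mul_mem_Ioo ha hz
  have hone := tendsto_log_mul_log_qPoch_mul (y := 1) (by simp)
  simp only [mul_one] at hone
  have h := ((hone.sub (tendsto_log_mul_log_qPoch ha)).add
    (tendsto_log_mul_log_qPoch haz)).sub (tendsto_log_mul_log_qPoch hz)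
  have hF := fiveTermDefect_eq ha hz
  rw [fiveTermDefect, sub_eq_iff_eq_add] at hF
  rw [hF, show Li2 1 - Li2 a + (Li2 (a * z) - Li2 z) = Li2 1 - Li2 a + Li2 (a * z) - Li2 z by ring]
  refine h.congr' ?_
  filter_upwards [self_mem_nhdsWithin] with q hq
  have hterm (n : ℕ) : phi q (a * q ^ n) * z ^ n / phi q (q ^ (n + 1))
      = qBinomCoeff q a n * z ^ n := by
    simp only [phi, qBinomCoeff, qPoch]
    rw [div_div_eq_mul_div, div_one]
    ring
  have pq := qPoch_pos hq hq
  have pa := qPoch_pos hq ha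
  have paz := qPoch_pos hq haz
  have pz := qPoch_pos hq hz
  have hS : ∑' n : ℕ, phi q (a * q ^ n) * z ^ n / phi q (q ^ (n + 1))
      = qPoch q (a * z) * (qPoch q q / qPoch q a) / qPoch q z := by
    rw [tsum_congr hterm, eq_div_iff pz.ne', mul_comm, tsum_qBinomCoeff hq ha hz]
  rw [hS, Real.log_div (by positivity) pz.ne', Real.log_mul paz.ne' (by positivity),
    Real.log_div pq.ne' pa.ne']
  ring
end

section
/- Fix $a,z\in(0,1)$. Then $\lim_{q\to 1^-}\ln(q)\,\ln\Big(\frac{\phi_q(a)\phi_q(z)}{\phi_q(q)\phi_q(az)}\Big)=\mathrm{Li}_2(1)+\mathrm{Li}_2(az)-\mathrm{Li}_2(a)-\mathrm{Li}_2(z)$. -/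
/-- Lambert-type series for `φ_q(y)`: its logarithm is `∑_{k≥1} y^k / (k (1 - q^k))`. -/
theorem phi_eq_exp_tsum {q y : ℝ} (hq : q ∈ Set.Ioo (0 : ℝ) 1) (hy : y ∈ Set.Ico (0 : ℝ) 1) :
    phi q y = Real.exp (∑' k : ℕ, y ^ (k + 1) / (((k : ℝ) + 1) * (1 - q ^ (k + 1)))) := by
  obtain ⟨hq0, hq1⟩ := hq
  obtain ⟨hy0, hy1⟩ := hy
  have hpow (k : ℕ) : q ^ (k + 1) < 1 := pow_lt_one₀ hq0.le hq1 k.succ_ne_zero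
  have hlt (n : ℕ) : q ^ n * y < 1 :=
    (mul_le_of_le_one_left hy0 (pow_le_one₀ hq0.le hq1.le)).trans_lt hy1
  obtain ⟨f, hf⟩ : ∃ f : ℕ × ℕ → ℝ,
      ∀ p, f p = (q ^ p.2 * y) ^ (p.1 + 1) / ((p.1 : ℝ) + 1) := ⟨_, fun _ => rfl⟩
  have hf0 : 0 ≤ f := fun p => by
    rw [hf, Pi.zero_apply]
    positivity
  have hrow (k : ℕ) : HasSum (fun n => f (k, n))
      (y ^ (k + 1) / (((k : ℝ) + 1) * (1 - q ^ (k + 1)))) := by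
    have h := (hasSum_geometric_of_lt_one (by positivity) (hpow k)).mul_left
      (y ^ (k + 1) / ((k : ℝ) + 1))
    rw [← div_eq_mul_inv, div_div] at h
    have hfun : (fun n => f (k, n)) =
        fun n => y ^ (k + 1) / ((k : ℝ) + 1) * (q ^ (k + 1)) ^ n := by
      funext n
      rw [hf, mul_pow, ← pow_mul, ← pow_mul, mul_comm n]
      ring
    rwa [hfun]
  have hcol (n : ℕ) : HasSum (fun k => f (k, n)) (-Real.log (1 - q ^ n * y)) := by
    simp_rw [hf]
    exact Real.hasSum_pow_div_log_of_abs_lt_one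
      (by rw [abs_of_nonneg (by positivity)]; exact hlt n)
  have hsum : Summable f := by
    refine (summable_prod_of_nonneg hf0).2 ⟨fun k => (hrow k).summable, ?_⟩
    simp_rw [fun k => (hrow k).tsum_eq]
    have hg : Summable fun k : ℕ => y * (1 - q)⁻¹ * y ^ k :=
      (summable_geometric_of_lt_one hy0 hy1).mul_left _
    refine Summable.of_nonneg_of_le (fun k => ?_) (fun k => ?_) hg
    · have := hpow k
      exact div_nonneg (by positivity) (mul_nonneg (by positivity) (by linarith))
    · have h1 : 1 - q ≤ ((k : ℝ) + 1) * (1 - q ^ (k + 1)) := by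
        have h2 : q ^ (k + 1) ≤ q := pow_le_of_le_one hq0.le hq1.le k.succ_ne_zero
        have h3 : (0 : ℝ) ≤ k := k.cast_nonneg
        nlinarith
      calc y ^ (k + 1) / (((k : ℝ) + 1) * (1 - q ^ (k + 1)))
          ≤ y ^ (k + 1) / (1 - q) :=
            div_le_div_of_nonneg_left (by positivity) (by linarith) h1
        _ = y * (1 - q)⁻¹ * y ^ k := by rw [pow_succ]; ring
  have hT := hsum.hasSum.prod_fiberwise hrow
  have hS : HasSum (fun n => -Real.log (1 - q ^ n * y)) (∑' p, f p) :=
    ((Equiv.prodComm ℕ ℕ).hasSum_iff.2 hsum.hasSum).prod_fiberwise hcol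
  have hL : HasSum (fun n => Real.log (1 - q ^ n * y)) (-∑' p, f p) := by
    simpa using hS.neg
  have hP := Real.hasProd_of_hasSum_log (fun n => sub_pos.2 (hlt n)) hL
  rw [phi, hP.tprod_eq, hT.tsum_eq, Real.exp_neg, one_div, inv_inv]

/-- `ln(q) / (1 - q^m) → -1/m` as `q → 1⁻`. -/
theorem tendsto_log_div_one_sub_pow (k : ℕ) :
    Filter.Tendsto (fun q : ℝ => Real.log q / (1 - q ^ (k + 1)))
      (nhdsWithin 1 (Set.Ioo (0 : ℝ) 1)) (nhds (-((k : ℝ) + 1)⁻¹)) := by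
  have hslope := (hasDerivAt_iff_tendsto_slope.1 (Real.hasDerivAt_log (one_ne_zero (α := ℝ))))
  have hpow : Filter.Tendsto (fun q : ℝ => q ^ (k + 1)) (nhdsWithin 1 (Set.Ioo (0 : ℝ) 1))
      (nhdsWithin 1 {1}ᶜ) := by
    refine tendsto_nhdsWithin_iff.2 ⟨?_, ?_⟩
    · have : Filter.Tendsto (fun q : ℝ => q ^ (k + 1)) (nhds 1) (nhds (1 ^ (k + 1))) :=
        (continuous_pow (k + 1)).tendsto 1
      rw [one_pow] at this
      exact this.mono_left nhdsWithin_le_nhds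
    · filter_upwards [self_mem_nhdsWithin] with q hq
      exact (pow_lt_one₀ hq.1.le hq.2 k.succ_ne_zero).ne
  have h := (hslope.comp hpow).mul_const (-((k : ℝ) + 1)⁻¹)
  rw [inv_one, one_mul] at h
  refine h.congr' ?_
  filter_upwards [self_mem_nhdsWithin] with q hq
  have h1 : 1 - q ^ (k + 1) ≠ 0 :=
    (sub_pos.2 (pow_lt_one₀ hq.1.le hq.2 k.succ_ne_zero)).ne'
  have h2 : q ^ (k + 1) - 1 ≠ 0 := by rwa [← neg_sub, neg_ne_zero]
  have h3 : (k : ℝ) + 1 ≠ 0 := by positivity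
  simp only [Function.comp_apply, slope_def_field, Real.log_one, sub_zero, Real.log_pow]
  push_cast
  field_simp
  ring

/-- Dominated convergence for `ln(q) ln(φ_q(u(q)))`. -/
theorem tendsto_log_mul_log_phi {u : ℝ → ℝ} {y : ℝ} {bound : ℕ → ℝ}
    (hu : Filter.Tendsto u (nhdsWithin 1 (Set.Ioo (0 : ℝ) 1)) (nhds y))
    (hmem : ∀ q ∈ Set.Ioo (0 : ℝ) 1, u q ∈ Set.Ico (0 : ℝ) 1) (hbound : Summable bound)
    (hle : ∀ᶠ q in nhdsWithin 1 (Set.Ioo (0 : ℝ) 1), ∀ k : ℕ,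
      -Real.log q * (u q ^ (k + 1) / (((k : ℝ) + 1) * (1 - q ^ (k + 1)))) ≤ bound k) :
    Filter.Tendsto (fun q => Real.log q * Real.log (phi q (u q)))
      (nhdsWithin 1 (Set.Ioo (0 : ℝ) 1)) (nhds (-Li2 y)) := by
  have key : Filter.Tendsto (fun q => ∑' k : ℕ,
      Real.log q * (u q ^ (k + 1) / (((k : ℝ) + 1) * (1 - q ^ (k + 1)))))
      (nhdsWithin 1 (Set.Ioo (0 : ℝ) 1))
      (nhds (∑' k : ℕ, -(y ^ (k + 1) / ((k : ℝ) + 1) ^ 2))) := by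
    refine tendsto_tsum_of_dominated_convergence hbound (fun k => ?_) ?_
    · have h := ((hu.pow (k + 1)).div_const ((k : ℝ) + 1)).mul (tendsto_log_div_one_sub_pow k)
      convert h using 2
      · rw [← div_div]; ring
      · rw [sq, ← div_div]; ring
    · filter_upwards [hle, self_mem_nhdsWithin] with q hq hq' k
      have h1 := (hmem q hq').1
      have h2 := pow_lt_one₀ hq'.1.le hq'.2 k.succ_ne_zero
      rw [norm_mul, Real.norm_of_nonpos (Real.log_nonpos hq'.1.le hq'.2.le),
        Real.norm_of_nonneg (div_nonneg (by positivity)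
          (mul_nonneg (by positivity) (sub_nonneg.2 h2.le)))]
      exact hq k
  rw [tsum_neg] at key
  refine key.congr' ?_
  filter_upwards [self_mem_nhdsWithin] with q hq
  rw [phi_eq_exp_tsum hq (hmem q hq), Real.log_exp, tsum_mul_left]

theorem tendsto_log_mul_log_phi_const {y : ℝ} (hy : y ∈ Set.Ico (0 : ℝ) 1) :
    Filter.Tendsto (fun q => Real.log q * Real.log (phi q y))
      (nhdsWithin 1 (Set.Ioo (0 : ℝ) 1)) (nhds (-Li2 y)) := by
  refine tendsto_log_mul_log_phi (u := fun _ => y) (bound := fun k => 2 * y * y ^ k)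
    tendsto_const_nhds (fun _ _ => hy)
    ((summable_geometric_of_lt_one hy.1 hy.2).mul_left _) ?_
  have hhalf : ∀ᶠ q : ℝ in nhdsWithin 1 (Set.Ioo (0 : ℝ) 1), 1 / 2 < q :=
    nhdsWithin_le_nhds (lt_mem_nhds (by norm_num))
  filter_upwards [self_mem_nhdsWithin, hhalf] with q hq hq2 k
  have hq1 : 0 < 1 - q := sub_pos.2 hq.2
  have h1 : 1 - q ≤ ((k : ℝ) + 1) * (1 - q ^ (k + 1)) := by
    have h2 : q ^ (k + 1) ≤ q := pow_le_of_le_one hq.1.le hq.2.le k.succ_ne_zero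
    have h3 : (0 : ℝ) ≤ k := k.cast_nonneg
    nlinarith
  have hlog : -Real.log q ≤ 2 * (1 - q) := by
    have h := Real.one_sub_inv_le_log_of_pos hq.1
    have h' : q⁻¹ - 1 ≤ 2 * (1 - q) := by
      rw [sub_le_iff_le_add, inv_le_iff_one_le_mul₀ hq.1]
      nlinarith
    linarith
  have hy0 := hy.1
  rw [← mul_div_assoc, div_le_iff₀ (hq1.trans_le h1)]
  calc -Real.log q * y ^ (k + 1) ≤ 2 * (1 - q) * y ^ (k + 1) := by gcongr
    _ = 2 * y * y ^ k * (1 - q) := by rw [pow_succ]; ring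
    _ ≤ _ := by gcongr

theorem tendsto_log_mul_log_phi_self :
    Filter.Tendsto (fun q => Real.log q * Real.log (phi q q))
      (nhdsWithin 1 (Set.Ioo (0 : ℝ) 1)) (nhds (-Li2 1)) := by
  refine tendsto_log_mul_log_phi (u := fun q => q) (bound := fun k => 1 / ((k : ℝ) + 1) ^ 2)
    (Filter.tendsto_id.mono_left nhdsWithin_le_nhds) (fun _ hq => Set.Ioo_subset_Ico_self hq)
    ?_ ?_
  · have h := (summable_nat_add_iff 1).2 (Real.summable_one_div_nat_pow.2 one_lt_two)
    simpa using h
  · filter_upwards [self_mem_nhdsWithin] with q hq k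
    have hp0 : 0 < q ^ (k + 1) := pow_pos hq.1 _
    have hp1 : 0 < 1 - q ^ (k + 1) := sub_pos.2 (pow_lt_one₀ hq.1.le hq.2 k.succ_ne_zero)
    have h := Real.one_sub_inv_le_log_of_pos hp0
    rw [Real.log_pow] at h
    push_cast at h
    have h2 := mul_le_mul_of_nonneg_right h hp0.le
    rw [sub_mul, inv_mul_cancel₀ hp0.ne', one_mul] at h2
    have hk : (0 : ℝ) < (k : ℝ) + 1 := by positivity
    rw [← mul_div_assoc, div_le_div_iff₀ (by positivity) (by positivity)]
    nlinarith

theorem phi_pos {q y : ℝ} (hq : q ∈ Set.Ioo (0 : ℝ) 1) (hy : y ∈ Set.Ico (0 : ℝ) 1) :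
    0 < phi q y := by
  rw [phi_eq_exp_tsum hq hy]
  exact Real.exp_pos _

/-- For fixed `a, z ∈ (0,1)`:
`lim_{q→1⁻} ln(q) ln(φ_q(a)φ_q(z)/(φ_q(q)φ_q(az))) = Li₂(1) + Li₂(az) - Li₂(a) - Li₂(z)`. -/
theorem limit_log_phi_ratio (a z : ℝ) (ha : a ∈ Set.Ioo (0 : ℝ) 1)
    (hz : z ∈ Set.Ioo (0 : ℝ) 1) :
    Filter.Tendsto
      (fun q : ℝ => Real.log q *
        Real.log (phi q a * phi q z / (phi q q * phi q (a * z))))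
      (nhdsWithin 1 (Set.Ioo (0 : ℝ) 1))
      (nhds (Li2 1 + Li2 (a * z) - Li2 a - Li2 z)) := by
  have ha' := Set.Ioo_subset_Ico_self ha
  have hz' := Set.Ioo_subset_Ico_self hz
  have haz : a * z ∈ Set.Ico (0 : ℝ) 1 :=
    ⟨mul_nonneg ha'.1 hz'.1, mul_lt_one_of_nonneg_of_lt_one_left ha'.1 ha.2 hz.2.le⟩
  have h := ((tendsto_log_mul_log_phi_const ha').add (tendsto_log_mul_log_phi_const hz')).sub
    (tendsto_log_mul_log_phi_self.add (tendsto_log_mul_log_phi_const haz))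
  have hlim : -Li2 a + -Li2 z - (-Li2 1 + -Li2 (a * z)) =
      Li2 1 + Li2 (a * z) - Li2 a - Li2 z := by ring
  rw [hlim] at h
  refine h.congr' ?_
  filter_upwards [self_mem_nhdsWithin] with q hq
  have h1 := (phi_pos hq ha').ne'
  have h2 := (phi_pos hq hz').ne'
  have h3 := (phi_pos hq (Set.Ioo_subset_Ico_self hq)).ne'
  have h4 := (phi_pos hq haz).ne'
  rw [Real.log_div (mul_ne_zero h1 h2) (mul_ne_zero h3 h4), Real.log_mul h1 h2,
    Real.log_mul h3 h4]
  ring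
end

section
/- For all real $q,a,z$ with $0<q<1$, $0\le a<1$ and $0\le z<1$, the series $\sum_{n\ge 0}\frac{\phi(aq^{n})}{\phi(q^{n+1})}z^n$ converges and equals $\frac{\phi(a)\phi(z)}{\phi(q)\phi(az)}$, where $\phi(y)=1/\prod_{n\ge 0}(1-q^n y)$. -/
open Filter Topology

lemma summable_qpow_mul {q : ℝ} (hq : 0 < q) (hq1 : q < 1) (y : ℝ) :
    Summable fun n : ℕ => -(q ^ n * y) :=
  ((summable_geometric_of_lt_one hq.le hq1).mul_right y).neg

lemma multipliable_one_sub_qpow_mul {q : ℝ} (hq : 0 < q) (hq1 : q < 1) (y : ℝ) :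
    Multipliable fun n : ℕ => 1 - q ^ n * y := by
  simpa [sub_eq_add_neg] using
    Real.multipliable_one_add_of_summable (summable_qpow_mul hq hq1 y)

lemma qpow_mul_lt_one {q y : ℝ} (hq : 0 < q) (hq1 : q < 1) (hy0 : 0 ≤ y) (hy1 : y < 1)
    (n : ℕ) :
    q ^ n * y < 1 :=
  (mul_le_of_le_one_left hy0 (pow_le_one₀ hq.le hq1.le)).trans_lt hy1

lemma tprod_one_sub_qpow_mul_pos {q y : ℝ} (hq : 0 < q) (hq1 : q < 1)
    (hy0 : 0 ≤ y) (hy1 : y < 1) : 0 < ∏' n : ℕ, (1 - q ^ n * y) := by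
  have hlog := Real.summable_log_one_add_of_summable (summable_qpow_mul hq hq1 y)
  simp only [← sub_eq_add_neg] at hlog
  rw [← Real.rexp_tsum_eq_tprod
    (fun n => sub_pos.2 (qpow_mul_lt_one hq hq1 hy0 hy1 n)) hlog]
  exact Real.exp_pos _

lemma tprod_one_sub_qpow_mul_le_one {q y : ℝ} (hq : 0 < q) (hq1 : q < 1)
    (hy0 : 0 ≤ y) (hy1 : y < 1) : ∏' n : ℕ, (1 - q ^ n * y) ≤ 1 :=
  le_of_tendsto' (multipliable_one_sub_qpow_mul hq hq1 y).hasProd.tendsto_prod_nat fun _ =>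
    Finset.prod_le_one (fun n _ => sub_nonneg.2 (qpow_mul_lt_one hq hq1 hy0 hy1 n).le)
      fun n _ => sub_le_self _ (by positivity)

lemma tprod_one_sub_qpow_mul_eq {q : ℝ} (hq : 0 < q) (hq1 : q < 1) (y : ℝ) :
    ∏' n : ℕ, (1 - q ^ n * y) = (1 - y) * ∏' n : ℕ, (1 - q ^ n * (y * q)) := by
  have hshift : (fun n : ℕ => 1 - q ^ (n + 1) * y) = fun n : ℕ => 1 - q ^ n * (y * q) := by
    ext n; ring
  have h := tprod_eq_zero_mul' (f := fun n : ℕ => 1 - q ^ n * y)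
    (by rw [hshift]; exact multipliable_one_sub_qpow_mul hq hq1 _)
  simpa [hshift] using h

lemma phi_mul_eq {q y : ℝ} (hq : 0 < q) (hq1 : q < 1) (hy1 : y < 1) :
    phi q (y * q) = (1 - y) * phi q y := by
  rw [phi, phi, tprod_one_sub_qpow_mul_eq hq hq1 y, mul_one_div,
    div_mul_cancel_left₀ (sub_pos.2 hy1).ne', one_div]

lemma phi_pos_s18 {q y : ℝ} (hq : 0 < q) (hq1 : q < 1) (hy0 : 0 ≤ y) (hy1 : y < 1) :
    0 < phi q y :=
  one_div_pos.2 (tprod_one_sub_qpow_mul_pos hq hq1 hy0 hy1)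

lemma one_le_phi {q y : ℝ} (hq : 0 < q) (hq1 : q < 1) (hy0 : 0 ≤ y) (hy1 : y < 1) :
    1 ≤ phi q y :=
  (one_le_div (tprod_one_sub_qpow_mul_pos hq hq1 hy0 hy1)).2
    (tprod_one_sub_qpow_mul_le_one hq hq1 hy0 hy1)

lemma phi_mul_qpow_le {q a : ℝ} (hq : 0 < q) (hq1 : q < 1) (ha0 : 0 ≤ a) (ha1 : a < 1)
    (n : ℕ) :
    phi q (a * q ^ n) ≤ phi q a := by
  induction n with
  | zero => simp
  | succ n ih =>
    have h0 : 0 ≤ a * q ^ n := by positivity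
    have h1 : a * q ^ n < 1 := mul_comm a _ ▸ qpow_mul_lt_one hq hq1 ha0 ha1 n
    rw [pow_succ, ← mul_assoc, phi_mul_eq hq hq1 h1]
    exact (mul_le_of_le_one_left (phi_pos_s18 hq hq1 h0 h1).le (by linarith)).trans ih

/-- The coefficient of `zⁿ` in the `q`-binomial series. -/
noncomputable def qBinomialCoeff (q a : ℝ) (n : ℕ) : ℝ :=
  phi q (a * q ^ n) / phi q (q ^ (n + 1))

lemma norm_qBinomialCoeff_le {q a : ℝ} (hq : 0 < q) (hq1 : q < 1)
    (ha0 : 0 ≤ a) (ha1 : a < 1) (n : ℕ) : ‖qBinomialCoeff q a n‖ ≤ phi q a := by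
  have hqn : q ^ (n + 1) < 1 := pow_lt_one₀ hq.le hq1 n.succ_ne_zero
  have h1 : a * q ^ n < 1 := mul_comm a _ ▸ qpow_mul_lt_one hq hq1 ha0 ha1 n
  have hpos := phi_pos_s18 hq hq1 (by positivity) h1
  have hone := one_le_phi hq hq1 (by positivity) hqn
  rw [qBinomialCoeff, Real.norm_of_nonneg (by positivity)]
  exact (div_le_self hpos.le hone).trans (phi_mul_qpow_le hq hq1 ha0 ha1 n)

lemma qBinomialCoeff_succ {q a : ℝ} (hq : 0 < q) (hq1 : q < 1)
    (ha0 : 0 ≤ a) (ha1 : a < 1) (n : ℕ) :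
    (1 - q ^ (n + 1)) * qBinomialCoeff q a (n + 1) = (1 - a * q ^ n) * qBinomialCoeff q a n := by
  have hqn : q ^ (n + 1) < 1 := pow_lt_one₀ hq.le hq1 n.succ_ne_zero
  have h1 : a * q ^ n < 1 := mul_comm a _ ▸ qpow_mul_lt_one hq hq1 ha0 ha1 n
  have hpos := phi_pos_s18 hq hq1 (by positivity) hqn
  have hne := (sub_pos.2 hqn).ne'
  rw [qBinomialCoeff, qBinomialCoeff, pow_succ q (n + 1), phi_mul_eq hq hq1 hqn,
    pow_succ q n, ← mul_assoc a, phi_mul_eq hq hq1 h1, ← pow_succ]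
  field_simp

lemma summable_qBinomialCoeff_mul_pow {q a : ℝ} (hq : 0 < q) (hq1 : q < 1)
    (ha0 : 0 ≤ a) (ha1 : a < 1) {z : ℝ} (hz0 : 0 ≤ z) (hz1 : z < 1) :
    Summable fun n => qBinomialCoeff q a n * z ^ n := by
  refine ((summable_geometric_of_lt_one hz0 hz1).mul_left (phi q a)).of_norm_bounded fun n => ?_
  rw [norm_mul, Real.norm_of_nonneg (pow_nonneg hz0 n)]
  gcongr
  exact norm_qBinomialCoeff_le hq hq1 ha0 ha1 n

lemma one_sub_mul_tsum_qBinomialCoeff {q a : ℝ} (hq : 0 < q) (hq1 : q < 1)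
    (ha0 : 0 ≤ a) (ha1 : a < 1) {z : ℝ} (hz0 : 0 ≤ z) (hz1 : z < 1) :
    (1 - z) * ∑' n, qBinomialCoeff q a n * z ^ n =
      (1 - a * z) * ∑' n, qBinomialCoeff q a n * (q * z) ^ n := by
  have hs := summable_qBinomialCoeff_mul_pow hq hq1 ha0 ha1 hz0 hz1
  have hqs := summable_qBinomialCoeff_mul_pow hq hq1 ha0 ha1 (z := q * z) (by positivity)
    (by simpa using qpow_mul_lt_one hq hq1 hz0 hz1 1)
  have hdiff : ∑' n, qBinomialCoeff q a n * z ^ n - ∑' n, qBinomialCoeff q a n * (q * z) ^ n =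
      z * ∑' n, qBinomialCoeff q a n * z ^ n -
        a * z * ∑' n, qBinomialCoeff q a n * (q * z) ^ n := by
    rw [← hs.tsum_sub hqs, (hs.sub hqs).tsum_eq_zero_add, ← tsum_mul_left, ← tsum_mul_left,
      ← (hs.mul_left z).tsum_sub (hqs.mul_left (a * z))]
    simp only [pow_zero, sub_self, zero_add]
    refine tsum_congr fun n => ?_
    simp only [mul_pow]
    linear_combination z ^ (n + 1) * qBinomialCoeff_succ hq hq1 ha0 ha1 n
  linear_combination hdiff

lemma prod_mul_tsum_qBinomialCoeff {q a : ℝ} (hq : 0 < q) (hq1 : q < 1)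
    (ha0 : 0 ≤ a) (ha1 : a < 1) {z : ℝ} (hz0 : 0 ≤ z) (hz1 : z < 1) (N : ℕ) :
    (∏ i ∈ Finset.range N, (1 - q ^ i * z)) * ∑' n, qBinomialCoeff q a n * z ^ n =
      (∏ i ∈ Finset.range N, (1 - q ^ i * (a * z))) *
        ∑' n, qBinomialCoeff q a n * (q ^ N * z) ^ n := by
  induction N with
  | zero => simp
  | succ N ih =>
    have h := one_sub_mul_tsum_qBinomialCoeff hq hq1 ha0 ha1 (z := q ^ N * z) (by positivity)
      (qpow_mul_lt_one hq hq1 hz0 hz1 N)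
    rw [← mul_assoc q, ← pow_succ'] at h
    rw [Finset.prod_range_succ, Finset.prod_range_succ]
    linear_combination (1 - q ^ N * z) * ih + (∏ i ∈ Finset.range N, (1 - q ^ i * (a * z))) * h

lemma tendsto_tsum_qBinomialCoeff {q a : ℝ} (hq : 0 < q) (hq1 : q < 1)
    (ha0 : 0 ≤ a) (ha1 : a < 1) {z : ℝ} (hz0 : 0 ≤ z) (hz1 : z < 1) :
    Tendsto (fun N : ℕ => ∑' n, qBinomialCoeff q a n * (q ^ N * z) ^ n) atTop
      (𝓝 (qBinomialCoeff q a 0)) := by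
  have hzero : ∑' n, qBinomialCoeff q a n * (0 : ℝ) ^ n = qBinomialCoeff q a 0 := by
    rw [tsum_eq_single 0 fun n hn => by simp [hn]]
    simp
  rw [← hzero]
  refine tendsto_tsum_of_dominated_convergence (bound := fun n => phi q a * z ^ n)
    ((summable_geometric_of_lt_one hz0 hz1).mul_left _) (fun n => ?_)
    (Eventually.of_forall fun N n => ?_)
  · have h : Tendsto (fun N : ℕ => q ^ N * z) atTop (𝓝 0) := by
      simpa using (tendsto_pow_atTop_nhds_zero_of_lt_one hq.le hq1).mul_const z
    exact (h.pow n).const_mul _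
  · rw [norm_mul, Real.norm_of_nonneg (by positivity : 0 ≤ (q ^ N * z) ^ n)]
    have := (norm_nonneg _).trans (norm_qBinomialCoeff_le hq hq1 ha0 ha1 n)
    gcongr
    · exact norm_qBinomialCoeff_le hq hq1 ha0 ha1 n
    · exact mul_le_of_le_one_left hz0 (pow_le_one₀ hq.le hq1.le)

/-- The q-binomial formula in terms of `φ`: for `0 < q < 1`, `0 ≤ a < 1`, `0 ≤ z < 1`,
the series `∑_{n≥0} (φ(aqⁿ)/φ(q^{n+1})) zⁿ` converges and equals
`φ(a)φ(z)/(φ(q)φ(az))`. -/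
theorem q_binomial_phi (q a z : ℝ) (hq : 0 < q) (hq1 : q < 1)
    (ha0 : 0 ≤ a) (ha1 : a < 1) (hz0 : 0 ≤ z) (hz1 : z < 1) :
    (Summable fun n : ℕ => phi q (a * q ^ n) / phi q (q ^ (n + 1)) * z ^ n) ∧
      (∑' n : ℕ, phi q (a * q ^ n) / phi q (q ^ (n + 1)) * z ^ n) =
        phi q a * phi q z / (phi q q * phi q (a * z)) := by
  refine ⟨summable_qBinomialCoeff_mul_pow hq hq1 ha0 ha1 hz0 hz1, ?_⟩
  change ∑' n, qBinomialCoeff q a n * z ^ n = _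
  have hlim := ((multipliable_one_sub_qpow_mul hq hq1 z).hasProd.tendsto_prod_nat.mul_const
    (∑' n, qBinomialCoeff q a n * z ^ n)).congr
      (prod_mul_tsum_qBinomialCoeff hq hq1 ha0 ha1 hz0 hz1)
  have heq := tendsto_nhds_unique hlim
    ((multipliable_one_sub_qpow_mul hq hq1 (a * z)).hasProd.tendsto_prod_nat.mul
      (tendsto_tsum_qBinomialCoeff hq hq1 ha0 ha1 hz0 hz1))
  have hz := (tprod_one_sub_qpow_mul_pos hq hq1 hz0 hz1).ne'
  rw [eq_div_of_mul_eq hz ((mul_comm _ _).trans heq)]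
  simp only [qBinomialCoeff, pow_zero, mul_one, zero_add, pow_one, phi, div_eq_mul_inv,
    mul_inv, inv_inv]
  ring
end
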